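/- Let A ∈ ℝ^{m×n}, b ∈ ℝ^m, c ∈ ℝ^n define a well-behaved linear program and let (P, Q) be a 0-quasi-stable (i.e., stable) coloring of the LP. Then the reduced LP has exactly the same optimal value: OPT(A,b,c) = OPT(Â, b̂, ĉ). -/

import Mathlib

open Matrix BigOperators

/-- The optimal value of the LP `max cᵀx s.t. Ax ≤ b, x ≥ 0`,
as a supremum in `EReal` (so `⊥ = -∞` if infeasible, `⊤ = +∞` if unbounded). -/
noncomputable def lpOPT {m n : ℕ} (A : Matrix (Fin m) (Fin n) ℝ)
    (b : Fin m → ℝ) (c : Fin n → ℝ) : EReal :=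
  sSup ((fun x : Fin n → ℝ => ((c ⬝ᵥ x : ℝ) : EReal)) ''
    {x | (∀ i, A.mulVec x i ≤ b i) ∧ ∀ j, 0 ≤ x j})

/-- The LP is well behaved: its optimal value is finite, and remains finite
in a neighborhood of `(b, c)` (here `‖·‖` on `Fin _ → ℝ` is the sup norm). -/
def WellBehaved {m n : ℕ} (A : Matrix (Fin m) (Fin n) ℝ)
    (b : Fin m → ℝ) (c : Fin n → ℝ) : Prop :=
  ∃ ε : ℝ, 0 < ε ∧ ∀ (u : Fin m → ℝ) (v : Fin n → ℝ), ‖u‖ ≤ ε → ‖v‖ ≤ ε →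
    ∃ y : ℝ, lpOPT A (b + u) (c + v) = (y : EReal)

/-- `P : Fin k → Finset (Fin m)` is a partition of `{0,…,m-1}` into `k` nonempty blocks. -/
def IsColoring {m k : ℕ} (P : Fin k → Finset (Fin m)) : Prop :=
  (∀ i : Fin m, ∃! r, i ∈ P r) ∧ ∀ r, (P r).Nonempty

/-- The coloring `(P, Q)` of the LP `(A, b, c)` is stable (0-quasi-stable). -/
def StableLP {m n k l : ℕ} (A : Matrix (Fin m) (Fin n) ℝ)
    (b : Fin m → ℝ) (c : Fin n → ℝ)
    (P : Fin k → Finset (Fin m)) (Q : Fin l → Finset (Fin n)) : Prop :=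
  (∀ r s, ∀ i ∈ P r, ∀ i' ∈ P r,
      (∑ j ∈ Q s, A i j) = (∑ j ∈ Q s, A i' j) ∧ b i = b i') ∧
  (∀ r s, ∀ j ∈ Q s, ∀ j' ∈ Q s,
      (∑ i ∈ P r, A i j) = (∑ i ∈ P r, A i j') ∧ c j = c j')

/-- The reduced constraint matrix `Â(r,s) = A(P_r,Q_s)/√(|P_r|·|Q_s|)`. -/
noncomputable def reducedA {m n k ℓ : ℕ} (A : Matrix (Fin m) (Fin n) ℝ)
    (P : Fin k → Finset (Fin m)) (Q : Fin ℓ → Finset (Fin n)) :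
    Matrix (Fin k) (Fin ℓ) ℝ :=
  fun r s => (∑ i ∈ P r, ∑ j ∈ Q s, A i j) /
    Real.sqrt (((P r).card : ℝ) * ((Q s).card : ℝ))

/-- The reduced right-hand side `b̂(r) = b(P_r)/√|P_r|`. -/
noncomputable def reducedB {m k : ℕ} (b : Fin m → ℝ)
    (P : Fin k → Finset (Fin m)) : Fin k → ℝ :=
  fun r => (∑ i ∈ P r, b i) / Real.sqrt ((P r).card : ℝ)

/-- The reduced objective `ĉ(s) = c(Q_s)/√|Q_s|`. -/
noncomputable def reducedC {n ℓ : ℕ} (c : Fin n → ℝ)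
    (Q : Fin ℓ → Finset (Fin n)) : Fin ℓ → ℝ :=
  fun s => (∑ j ∈ Q s, c j) / Real.sqrt ((Q s).card : ℝ)

theorem sum_coloring {n l : ℕ} {Q : Fin l → Finset (Fin n)} (hQ : IsColoring Q)
    (f : Fin n → ℝ) : ∑ j, f j = ∑ s, ∑ j ∈ Q s, f j := by
  choose g hg hu using hQ.1
  have hm : ∀ j s, j ∈ Q s ↔ g j = s := fun j s =>
    ⟨fun h => (hu j s h).symm, fun h => h ▸ hg j⟩
  rw [← Finset.sum_fiberwise Finset.univ g f]
  refine Finset.sum_congr rfl fun s _ => Finset.sum_congr ?_ fun _ _ => rfl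
  ext j
  simp [hm]

theorem avg_of_const {n : ℕ} {S : Finset (Fin n)} (f : Fin n → ℝ)
    (h : ∀ j ∈ S, ∀ j' ∈ S, f j = f j') (j : Fin n) (hj : j ∈ S) :
    ∑ i ∈ S, f i = S.card * f j := by
  rw [Finset.sum_congr rfl (fun i hi => h i hi j hj)]
  simp

/-- For a well-behaved LP and a stable (0-quasi-stable) coloring, the reduced LP
has exactly the same optimal value. -/
theorem stable_lp_exact {m n : ℕ} (A : Matrix (Fin m) (Fin n) ℝ)
    (b : Fin m → ℝ) (c : Fin n → ℝ) (hwb : WellBehaved A b c)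
    {k l : ℕ} (P : Fin k → Finset (Fin m)) (Q : Fin l → Finset (Fin n))
    (hP : IsColoring P) (hQ : IsColoring Q) (hstable : StableLP A b c P Q) :
    lpOPT A b c = lpOPT (reducedA A P Q) (reducedB b P) (reducedC c Q) := by
  have hPc : ∀ r, 0 < Real.sqrt ((P r).card : ℝ) := fun r =>
    Real.sqrt_pos.2 (by exact_mod_cast (hP.2 r).card_pos)
  have hQc : ∀ s, 0 < Real.sqrt ((Q s).card : ℝ) := fun s =>
    Real.sqrt_pos.2 (by exact_mod_cast (hQ.2 s).card_pos)
  have hPs : ∀ r, ((P r).card : ℝ) = Real.sqrt ((P r).card : ℝ) * Real.sqrt ((P r).card : ℝ) :=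
    fun r => (Real.mul_self_sqrt (Nat.cast_nonneg _)).symm
  have hQs : ∀ s, ((Q s).card : ℝ) = Real.sqrt ((Q s).card : ℝ) * Real.sqrt ((Q s).card : ℝ) :=
    fun s => (Real.mul_self_sqrt (Nat.cast_nonneg _)).symm
  have hA : ∀ r s, reducedA A P Q r s = (∑ i ∈ P r, ∑ j ∈ Q s, A i j) /
      (Real.sqrt ((P r).card : ℝ) * Real.sqrt ((Q s).card : ℝ)) := fun r s => by
    rw [reducedA, Real.sqrt_mul (Nat.cast_nonneg _)]
  obtain ⟨h1, h2⟩ := hstable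
  obtain ⟨y, hy⟩ : ∃ y : ℝ, lpOPT A b c = (y : EReal) := by
    obtain ⟨ε, hε, h⟩ := hwb
    simpa using h 0 0 (by simpa using hε.le) (by simpa using hε.le)
  apply le_antisymm
  · refine sSup_le ?_
    rintro _ ⟨x, ⟨hx, hx0⟩, rfl⟩
    by_cases hk : Nonempty (Fin k)
    swap
    · have hle : c ⬝ᵥ x ≤ 0 := by
        by_contra hpos
        push Not at hpos
        have ht : 0 ≤ (|y| + 1) / (c ⬝ᵥ x) := by positivity
        have : ((c ⬝ᵥ (((|y| + 1) / (c ⬝ᵥ x)) • x) : ℝ) : EReal) ≤ lpOPT A b c :=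
          le_sSup ⟨_, ⟨fun i => (hk ⟨(hP.1 i).choose⟩).elim,
            fun j => mul_nonneg ht (hx0 j)⟩, rfl⟩
        rw [hy, EReal.coe_le_coe_iff, dotProduct_smul, smul_eq_mul,
          div_mul_cancel₀ _ hpos.ne'] at this
        linarith [le_abs_self y]
      have h0 : ((0 : ℝ) : EReal) ≤ lpOPT (reducedA A P Q) (reducedB b P) (reducedC c Q) :=
        le_sSup ⟨0, ⟨fun r => (hk ⟨r⟩).elim, fun j => le_rfl⟩, by simp⟩
      exact le_trans (EReal.coe_le_coe_iff.2 hle) h0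
    refine le_sSup ⟨fun s => (∑ j ∈ Q s, x j) / Real.sqrt ((Q s).card : ℝ), ⟨?_, ?_⟩, ?_⟩
    · intro r
      have key : (reducedA A P Q).mulVec
          (fun s => (∑ j ∈ Q s, x j) / Real.sqrt ((Q s).card : ℝ)) r
          = (∑ i ∈ P r, A.mulVec x i) / Real.sqrt ((P r).card : ℝ) := by
        have : ∑ i ∈ P r, A.mulVec x i = ∑ j, (∑ i ∈ P r, A i j) * x j := by
          simp only [Matrix.mulVec, dotProduct, Finset.sum_mul]
          exact Finset.sum_comm
        rw [this, sum_coloring hQ, Finset.sum_div]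
        simp only [Matrix.mulVec, dotProduct]
        refine Finset.sum_congr rfl fun s _ => ?_
        obtain ⟨j0, hj0⟩ := hQ.2 s
        have e1 : ∑ j ∈ Q s, (∑ i ∈ P r, A i j) * x j
            = (∑ i ∈ P r, A i j0) * ∑ j ∈ Q s, x j := by
          rw [Finset.mul_sum]
          exact Finset.sum_congr rfl fun j hj => by rw [(h2 r s j hj j0 hj0).1]
        have e2 : ∑ i ∈ P r, ∑ j ∈ Q s, A i j = (Q s).card * ∑ i ∈ P r, A i j0 :=
          Finset.sum_comm.trans (avg_of_const (fun j => ∑ i ∈ P r, A i j)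
            (fun j hj j' hj' => (h2 r s j hj j' hj').1) j0 hj0)
        rw [e1, hA, e2]
        have t1 := hPc r
        have t2 := hQc s
        have t3 := hQs s
        generalize Real.sqrt ((Q s).card : ℝ) = q at *
        rw [t3]
        clear t3 hPs hQs
        field_simp
      rw [key, reducedB]
      exact div_le_div_of_nonneg_right (Finset.sum_le_sum fun i _ => hx i) (hPc r).le
    · intro s
      exact div_nonneg (Finset.sum_nonneg fun j _ => hx0 j) (hQc s).le
    · have : reducedC c Q ⬝ᵥ (fun s => (∑ j ∈ Q s, x j) / Real.sqrt ((Q s).card : ℝ))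
          = c ⬝ᵥ x := by
        simp only [dotProduct]
        rw [sum_coloring hQ]
        refine Finset.sum_congr rfl fun s _ => ?_
        obtain ⟨j0, hj0⟩ := hQ.2 s
        have hc : ∀ j ∈ Q s, ∀ j' ∈ Q s, c j = c j' := fun j hj j' hj' =>
          (h2 hk.some s j hj j' hj').2
        have e1 : ∑ j ∈ Q s, c j * x j = c j0 * ∑ j ∈ Q s, x j := by
          rw [Finset.mul_sum]
          exact Finset.sum_congr rfl fun j hj => by rw [hc j hj j0 hj0]
        rw [e1, reducedC, avg_of_const c hc j0 hj0]
        have t2 := hQc s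
        have t3 := hQs s
        generalize Real.sqrt ((Q s).card : ℝ) = q at *
        rw [t3]
        clear t3 hPs hQs
        field_simp
      exact congrArg _ this
  · refine sSup_le ?_
    rintro _ ⟨z, ⟨hz, hz0⟩, rfl⟩
    choose g hg hu using hQ.1
    have hgs : ∀ s, ∀ j ∈ Q s, g j = s := fun s j h => (hu j s h).symm
    refine le_sSup ⟨fun j => z (g j) / Real.sqrt ((Q (g j)).card : ℝ), ⟨?_, ?_⟩, ?_⟩
    · intro i
      by_cases hl : Nonempty (Fin l)
      swap
      · have hne : ∃ x : Fin n → ℝ, (∀ i, A.mulVec x i ≤ b i) ∧ ∀ j, 0 ≤ x j := by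
          by_contra hno
          have : {x : Fin n → ℝ | (∀ i, A.mulVec x i ≤ b i) ∧ ∀ j, 0 ≤ x j} = ∅ :=
            Set.eq_empty_iff_forall_notMem.2 fun x hx => hno ⟨x, hx⟩
          rw [lpOPT, this, Set.image_empty, sSup_empty] at hy
          exact EReal.bot_ne_coe _ hy
        obtain ⟨x, hx, -⟩ := hne
        have : (fun j => z (g j) / Real.sqrt ((Q (g j)).card : ℝ)) = x :=
          funext fun j => (hl ⟨g j⟩).elim
        rw [this]
        exact hx i
      obtain ⟨r, hr, -⟩ := hP.1 i
      have key : A.mulVec (fun j => z (g j) / Real.sqrt ((Q (g j)).card : ℝ)) i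
          = (reducedA A P Q).mulVec z r / Real.sqrt ((P r).card : ℝ) := by
        simp only [Matrix.mulVec, dotProduct]
        rw [sum_coloring hQ, Finset.sum_div]
        refine Finset.sum_congr rfl fun s _ => ?_
        have e1 : ∑ j ∈ Q s, A i j * (z (g j) / Real.sqrt ((Q (g j)).card : ℝ))
            = (∑ j ∈ Q s, A i j) * (z s / Real.sqrt ((Q s).card : ℝ)) := by
          rw [Finset.sum_mul]
          exact Finset.sum_congr rfl fun j hj => by rw [hgs s j hj]
        have e2 : ∑ i ∈ P r, ∑ j ∈ Q s, A i j = (P r).card * ∑ j ∈ Q s, A i j :=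
          avg_of_const (fun i => ∑ j ∈ Q s, A i j)
            (fun j hj j' hj' => (h1 r s j hj j' hj').1) i hr
        rw [e1, hA, e2]
        have t1 := hPc r
        have t2 := hQc s
        have t3 := hPs r
        generalize Real.sqrt ((P r).card : ℝ) = q at *
        rw [t3]
        clear t3 hPs hQs
        field_simp
      have hb : b i = reducedB b P r / Real.sqrt ((P r).card : ℝ) := by
        rw [reducedB, avg_of_const b (fun j hj j' hj' => (h1 r hl.some j hj j' hj').2) i hr]
        have t1 := hPc r
        have t3 := hPs r
        generalize Real.sqrt ((P r).card : ℝ) = q at *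
        rw [t3]
        clear t3 hPs hQs
        field_simp
      rw [key, hb]
      exact div_le_div_of_nonneg_right (hz r) (hPc r).le
    · intro j
      exact div_nonneg (hz0 _) (hQc _).le
    · have : c ⬝ᵥ (fun j => z (g j) / Real.sqrt ((Q (g j)).card : ℝ))
          = reducedC c Q ⬝ᵥ z := by
        simp only [dotProduct]
        rw [sum_coloring hQ]
        refine Finset.sum_congr rfl fun s _ => ?_
        rw [reducedC, div_mul_eq_mul_div, mul_div_assoc, Finset.sum_mul]
        exact Finset.sum_congr rfl fun j hj => by rw [hgs s j hj]
      exact congrArg _ this
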